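/- arXiv:2003.09071 — 2 statements merged into one kernel-verified Lean document; each statement's English description precedes it below -/
import Mathlib

section
/- Suppose g is strictly increasing on [0,∞), and μ, μ₁, μ₂, μ₃, … are Borel measures on ℝⁿ with 0 < μ(ℝⁿ) < ∞ and 0 < μ_k(ℝⁿ) < ∞, all supported in a fixed compact set Y ⊂ ℝⁿ, with μ_k → μ weakly. For each of these measures write x_c(·) for the unique point where the associated vector field V vanishes (which exists and is unique). Then x_c(μ_k) → x_c(μ) as k → ∞. -/
open MeasureTheory Filter Set Topology

/-- The radial vector field `v(y) = g(|y|) y/|y|` (with `v(0)=0`). -/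
noncomputable def radialField {n : ℕ} (g : ℝ → ℝ)
    (y : EuclideanSpace ℝ (Fin n)) : EuclideanSpace ℝ (Fin n) :=
  (g ‖y‖ / ‖y‖) • y

/-- The vector field `V_ν(x) = ∫ v(x+y) dν(y)`. -/
noncomputable def VField {n : ℕ} (g : ℝ → ℝ)
    (ν : Measure (EuclideanSpace ℝ (Fin n)))
    (x : EuclideanSpace ℝ (Fin n)) : EuclideanSpace ℝ (Fin n) :=
  ∫ y, radialField g (x + y) ∂ν

lemma rf_inner_pos {n : ℕ} (g : ℝ → ℝ) (hg0 : g 0 = 0)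
    (hg_mono : StrictMonoOn g (Ici 0)) (a b : EuclideanSpace ℝ (Fin n)) (hab : a ≠ b) :
    0 < inner ℝ (radialField g a - radialField g b) (a - b) := by
  have hp : ∀ c : EuclideanSpace ℝ (Fin n), 0 ≤ g ‖c‖ / ‖c‖ ∧ (g ‖c‖ / ‖c‖) * ‖c‖ = g ‖c‖ := by
    intro c
    have h1 : g 0 ≤ g ‖c‖ := hg_mono.monotoneOn (mem_Ici.2 le_rfl) (mem_Ici.2 (norm_nonneg c))
      (norm_nonneg c)
    refine ⟨div_nonneg (by linarith) (norm_nonneg _), ?_⟩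
    by_cases hc : ‖c‖ = 0
    · rw [hc, hg0]; simp
    · field_simp
  obtain ⟨p0, pa⟩ := hp a
  obtain ⟨q0, qb⟩ := hp b
  unfold radialField
  by_cases hn : ‖a‖ = ‖b‖
  · rw [← hn, ← smul_sub, real_inner_smul_left, real_inner_self_eq_norm_sq]
    have h3 : 0 < ‖a - b‖ := norm_pos_iff.2 (sub_ne_zero.2 hab)
    have h4 : 0 < ‖a‖ := by
      rcases (norm_nonneg a).eq_or_lt with h | h
      · exfalso; apply hab
        rw [norm_eq_zero.1 h.symm, norm_eq_zero.1 (hn.symm.trans h.symm)]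
      · exact h
    have h5 : g 0 < g ‖a‖ := hg_mono (mem_Ici.2 le_rfl) (mem_Ici.2 h4.le) h4
    rw [hg0] at h5
    positivity
  · have key : 0 < (g ‖a‖ - g ‖b‖) * (‖a‖ - ‖b‖) := by
      rcases lt_or_gt_of_ne hn with h | h
      · have := hg_mono (mem_Ici.2 (norm_nonneg a)) (mem_Ici.2 (norm_nonneg b)) h
        nlinarith
      · have := hg_mono (mem_Ici.2 (norm_nonneg b)) (mem_Ici.2 (norm_nonneg a)) h
        nlinarith
    rw [← pa, ← qb] at key
    generalize g ‖a‖ / ‖a‖ = p at *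
    generalize g ‖b‖ / ‖b‖ = q at *
    have h6 := real_inner_le_norm a b
    simp only [inner_sub_left, inner_sub_right, real_inner_smul_left,
      real_inner_self_eq_norm_sq, real_inner_comm a b]
    have h7 := mul_le_mul_of_nonneg_left h6 (add_nonneg p0 q0)
    have h8 := real_inner_comm a b
    nlinarith

lemma rf_norm {n : ℕ} (g : ℝ → ℝ) (hg0 : g 0 = 0) (c : EuclideanSpace ℝ (Fin n)) :
    ‖radialField g c‖ = |g ‖c‖| := by
  unfold radialField
  rw [norm_smul, Real.norm_eq_abs, abs_div, abs_norm]
  by_cases hc : ‖c‖ = 0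
  · rw [hc, hg0]; simp
  · field_simp

lemma rf_cont {n : ℕ} (g : ℝ → ℝ) (hg_cont : ContinuousOn g (Ici 0)) (hg0 : g 0 = 0) :
    Continuous (radialField g : EuclideanSpace ℝ (Fin n) → _) := by
  have hgn : Continuous (fun c : EuclideanSpace ℝ (Fin n) => g ‖c‖) :=
    hg_cont.comp_continuous continuous_norm (fun c => mem_Ici.2 (norm_nonneg c))
  rw [continuous_iff_continuousAt]
  intro c
  by_cases hc : c = 0
  · subst hc
    have h0 : radialField g (0 : EuclideanSpace ℝ (Fin n)) = 0 := by simp [radialField]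
    rw [ContinuousAt, h0, tendsto_zero_iff_norm_tendsto_zero]
    simp only [rf_norm g hg0]
    have := (hgn.abs).tendsto 0
    simpa [hg0] using this
  · exact (hgn.continuousAt.div continuous_norm.continuousAt (norm_ne_zero_iff.2 hc)).smul
      continuousAt_id

lemma integrable_of_compact {n : ℕ} {F : Type*} [NormedAddCommGroup F]
    (ν : Measure (EuclideanSpace ℝ (Fin n))) (hfin : ν univ < ⊤)
    (Y : Set (EuclideanSpace ℝ (Fin n))) (hY : IsCompact Y) (hν : ν Yᶜ = 0)
    (f : EuclideanSpace ℝ (Fin n) → F) (hf : Continuous f) : Integrable f ν := by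
  have : IsFiniteMeasure ν := ⟨hfin⟩
  have h := hf.continuousOn.integrableOn_compact (μ := ν) hY
  have hae : ∀ᵐ y ∂ν, y ∈ Y := by rw [ae_iff]; exact hν
  rwa [IntegrableOn, Measure.restrict_eq_self_of_ae_mem hae] at h

theorem center_of_mass_continuous_dependence_compact {n : ℕ} (hn : 1 ≤ n)
    (g : ℝ → ℝ) (hg_cont : ContinuousOn g (Ici 0)) (hg0 : g 0 = 0)
    (hg_mono : StrictMonoOn g (Ici 0))
    (μ : Measure (EuclideanSpace ℝ (Fin n)))
    (μs : ℕ → Measure (EuclideanSpace ℝ (Fin n)))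
    (hμpos : 0 < μ Set.univ) (hμfin : μ Set.univ < ⊤)
    (hμspos : ∀ k, 0 < μs k Set.univ) (hμsfin : ∀ k, μs k Set.univ < ⊤)
    (Y : Set (EuclideanSpace ℝ (Fin n))) (hY : IsCompact Y)
    (hμY : μ Yᶜ = 0) (hμsY : ∀ k, μs k Yᶜ = 0)
    (hweak : ∀ ψ : EuclideanSpace ℝ (Fin n) → ℝ, Continuous ψ →
      (∃ C : ℝ, ∀ y, |ψ y| ≤ C) →
      Tendsto (fun k => ∫ y, ψ y ∂(μs k)) atTop (𝓝 (∫ y, ψ y ∂μ)))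
    (xc : ℕ → EuclideanSpace ℝ (Fin n)) (x : EuclideanSpace ℝ (Fin n))
    (hxc : ∀ k, VField g (μs k) (xc k) = 0) (hx : VField g μ x = 0) :
    Tendsto xc atTop (𝓝 x) := by
  have hvc := rf_cont (n := n) g hg_cont hg0
  have hvx : ∀ z : EuclideanSpace ℝ (Fin n), Continuous (fun y => radialField g (z + y)) :=
    fun z => hvc.comp (continuous_const.add continuous_id)
  have haeμ : ∀ᵐ y ∂μ, y ∈ Y := by rw [ae_iff]; exact hμY
  have haek : ∀ k, ∀ᵐ y ∂(μs k), y ∈ Y := fun k => by rw [ae_iff]; exact hμsY k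
  have hint : ∀ k z, Integrable (fun y => radialField g (z + y)) (μs k) := fun k z =>
    integrable_of_compact _ (hμsfin k) Y hY (hμsY k) _ (hvx z)
  have hintμ : ∀ z, Integrable (fun y => radialField g (z + y)) μ := fun z =>
    integrable_of_compact _ hμfin Y hY hμY _ (hvx z)
  -- masses converge
  have hmass : Tendsto (fun k => (μs k).real univ) atTop (𝓝 (μ.real univ)) := by
    have := hweak (fun _ => 1) continuous_const ⟨1, fun _ => by simp⟩
    simpa using this
  have hmpos : 0 < μ.real univ := ENNReal.toReal_pos hμpos.ne' hμfin.ne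
  have hmkpos : ∀ k, 0 < (μs k).real univ := fun k =>
    ENNReal.toReal_pos (hμspos k).ne' (hμsfin k).ne
  -- the field at `x` converges to zero
  have hV : Tendsto (fun k => VField g (μs k) x) atTop (𝓝 0) := by
    rw [← hx]
    have hcoord : ∀ i, Tendsto (fun k => (VField g (μs k) x) i) atTop (𝓝 ((VField g μ x) i)) := by
      intro i
      have hproj : ∀ ν : Measure (EuclideanSpace ℝ (Fin n)),
          Integrable (fun y => radialField g (x + y)) ν →
          (VField g ν x) i = ∫ y, (radialField g (x + y)) i ∂ν := by
        intro ν hν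
        exact ((EuclideanSpace.proj (𝕜 := ℝ) i).integral_comp_comm hν).symm
      have hci : Continuous (fun y => (radialField g (x + y)) i) :=
        (EuclideanSpace.proj (𝕜 := ℝ) i).continuous.comp (hvx x)
      obtain ⟨C, hC⟩ := hY.exists_bound_of_continuousOn hci.continuousOn
      let ψ : EuclideanSpace ℝ (Fin n) → ℝ := fun y =>
        max (-|C|) (min (|C|) ((radialField g (x + y)) i))
      have hψ : ∀ y ∈ Y, (radialField g (x + y)) i = ψ y := by
        intro y hy
        have h1 := (hC y hy).trans (le_abs_self C)
        rw [Real.norm_eq_abs, abs_le] at h1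
        simp only [ψ]
        rw [min_eq_right h1.2, max_eq_right h1.1]
      have hw := hweak ψ (continuous_const.max (continuous_const.min hci)) ⟨|C|, fun y => by
        rw [abs_le]
        exact ⟨le_max_left _ _, max_le (by linarith [abs_nonneg C]) (min_le_left _ _)⟩⟩
      rw [hproj μ (hintμ x), integral_congr_ae (haeμ.mono hψ)]
      refine hw.congr fun k => ?_
      rw [hproj (μs k) (hint k x), integral_congr_ae ((haek k).mono hψ)]
    have := ((PiLp.continuous_toLp 2 (fun _ : Fin n => ℝ)).tendsto _).comp
      (tendsto_pi_nhds.2 hcoord)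
    exact this
  -- boundedness of the centers
  obtain ⟨R, hR⟩ := hY.isBounded.exists_norm_le
  have hbd : ∀ k, ‖xc k‖ ≤ R := by
    intro k
    by_contra hlt
    push Not at hlt
    have hY0 : ∀ y ∈ Y, 0 < inner ℝ (xc k) (radialField g (xc k + y)) := by
      intro y hy
      have hyR := hR y hy
      have hx0 : 0 < ‖xc k‖ := lt_of_le_of_lt ((norm_nonneg y).trans hyR) hlt
      have h1 : 0 < inner ℝ (xc k) (xc k + y) := by
        rw [inner_add_right, real_inner_self_eq_norm_sq]
        have := (abs_le.1 (abs_real_inner_le_norm (xc k) y)).1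
        nlinarith
      have h2 : 0 < ‖xc k + y‖ := by
        rw [norm_pos_iff]; intro h; rw [h] at h1; simp at h1
      have h3 := hg_mono (mem_Ici.2 le_rfl) (mem_Ici.2 h2.le) h2
      rw [hg0] at h3
      unfold radialField
      rw [real_inner_smul_right]
      positivity
    have hz : ∫ y, inner ℝ (xc k) (radialField g (xc k + y)) ∂(μs k) = 0 := by
      rw [integral_inner (hint k (xc k))]
      have := hxc k
      unfold VField at this
      rw [this, inner_zero_right]
    have hae0 := (integral_eq_zero_iff_of_nonneg_ae
      ((haek k).mono fun y hy => (hY0 y hy).le) ((hint k (xc k)).const_inner (xc k))).1 hz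
    have : ∀ᵐ y ∂(μs k), False := by
      filter_upwards [hae0, haek k] with y h1 h2
      exact absurd h1 (hY0 y h2).ne'
    rw [ae_iff] at this
    simp only [not_false_eq_true, setOf_true] at this
    exact (hμspos k).ne' this
  -- conclusion
  rw [Metric.tendsto_nhds]
  intro ε hε
  let B : Set (EuclideanSpace ℝ (Fin n)) := Metric.closedBall 0 R
  let K : Set (EuclideanSpace ℝ (Fin n) × EuclideanSpace ℝ (Fin n)) :=
    (B ×ˢ Y) ∩ {p | ε ≤ dist p.1 x}
  have hK : IsCompact K := ((isCompact_closedBall 0 R).prod hY).inter_right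
    (isClosed_le continuous_const (continuous_fst.dist continuous_const))
  let Φ : EuclideanSpace ℝ (Fin n) × EuclideanSpace ℝ (Fin n) → ℝ := fun p =>
    inner ℝ (p.1 - x) (radialField g (p.1 + p.2) - radialField g (x + p.2))
  have hΦ : Continuous Φ := by
    refine (continuous_fst.sub continuous_const).inner (Continuous.sub ?_ ?_)
    · exact hvc.comp (continuous_fst.add continuous_snd)
    · exact hvc.comp (continuous_const.add continuous_snd)
  have hΦpos : ∀ p ∈ K, 0 < Φ p := by
    rintro ⟨z, y⟩ ⟨_, hd⟩
    have hne : z + y ≠ x + y := by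
      intro h
      have h' := add_right_cancel h
      simp only [mem_setOf_eq, h', dist_self] at hd
      linarith
    have := rf_inner_pos g hg0 hg_mono _ _ hne
    rw [add_sub_add_right_eq_sub, real_inner_comm] at this
    exact this
  obtain ⟨c, hc, hcK⟩ : ∃ c > 0, ∀ p ∈ K, c ≤ Φ p := by
    rcases K.eq_empty_or_nonempty with h | h
    · exact ⟨1, one_pos, by simp [h]⟩
    · obtain ⟨p, hp, hmin⟩ := hK.exists_isMinOn h hΦ.continuousOn
      exact ⟨Φ p, hΦpos p hp, fun q hq => hmin hq⟩
  have hlim : Tendsto (fun k => c * (μs k).real univ - (R + ‖x‖) * ‖VField g (μs k) x‖) atTop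
      (𝓝 (c * μ.real univ - (R + ‖x‖) * ‖(0 : EuclideanSpace ℝ (Fin n))‖)) :=
    (hmass.const_mul c).sub (hV.norm.const_mul _)
  have hev : ∀ᶠ k in atTop, 0 < c * (μs k).real univ - (R + ‖x‖) * ‖VField g (μs k) x‖ := by
    apply hlim.eventually_const_lt
    simp only [norm_zero, mul_zero, sub_zero]
    positivity
  have hfin : ∀ᶠ k in atTop, dist (xc k) x < ε := by
    filter_upwards [hev] with k hk
    by_contra hd
    push Not at hd
    have : IsFiniteMeasure (μs k) := ⟨hμsfin k⟩
    have hsub := (hint k (xc k)).sub (hint k x)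
    have h1 : ∫ y, Φ (xc k, y) ∂(μs k) = - inner ℝ (xc k - x) (VField g (μs k) x) := by
      have e1 : ∫ y, Φ (xc k, y) ∂(μs k) = inner ℝ (xc k - x)
          (∫ y, (radialField g (xc k + y) - radialField g (x + y)) ∂(μs k)) :=
        integral_inner (𝕜 := ℝ) hsub (xc k - x)
      rw [e1, integral_sub (hint k (xc k)) (hint k x)]
      have := hxc k
      unfold VField at this ⊢
      rw [this, zero_sub, inner_neg_right]
    have h2 : c * (μs k).real univ ≤ ∫ y, Φ (xc k, y) ∂(μs k) := by
      have : ∫ _y, c ∂(μs k) = c * (μs k).real univ := by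
        simp [mul_comm]
      rw [← this]
      refine integral_mono_ae (integrable_const c) (hsub.const_inner (xc k - x)) ?_
      filter_upwards [haek k] with y hy
      exact hcK (xc k, y) ⟨⟨by simpa [B] using hbd k, hy⟩, hd⟩
    have h3 := (abs_le.1 (abs_real_inner_le_norm (xc k - x) (VField g (μs k) x))).1
    have h4 : ‖xc k - x‖ ≤ R + ‖x‖ := (norm_sub_le _ _).trans (by linarith [hbd k])
    have h5 := mul_le_mul_of_nonneg_right h4 (norm_nonneg (VField g (μs k) x))
    linarith
  exact hfin
end

section
/- Assume the limiting value g(∞) = lim_{r→∞} g(r) exists and is finite. Suppose x_k → x̃ ∈ ℝⁿ, |y_k| → ∞, and y_k/|y_k| → ỹ for some unit vector ỹ. Then Γ(x_k + y_k) − Γ(y_k) → g(∞) · (x̃ · ỹ) as k → ∞. -/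
open MeasureTheory Filter Set Topology RealInnerProductSpace

/-- The energy kernel `Γ(x) = G(|x|)`, where `G(r) = ∫₀^r g(s) ds`. -/
noncomputable def Gam {n : ℕ} (g : ℝ → ℝ)
    (x : EuclideanSpace ℝ (Fin n)) : ℝ :=
  ∫ s in (0:ℝ)..‖x‖, g s

theorem renormalized_kernel_extends_to_infinity {n : ℕ} (hn : 1 ≤ n)
    (g : ℝ → ℝ) (hg_cont : ContinuousOn g (Ici 0)) (hg0 : g 0 = 0)
    (ginf : ℝ) (hg_lim : Tendsto g atTop (𝓝 ginf))
    (x y : ℕ → EuclideanSpace ℝ (Fin n))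
    (xt yt : EuclideanSpace ℝ (Fin n)) (hyt : ‖yt‖ = 1)
    (hx : Tendsto x atTop (𝓝 xt))
    (hy : Tendsto (fun k => ‖y k‖) atTop atTop)
    (hdir : Tendsto (fun k => ‖y k‖⁻¹ • y k) atTop (𝓝 yt)) :
    Tendsto (fun k => Gam g (x k + y k) - Gam g (y k)) atTop
      (𝓝 (ginf * ⟪xt, yt⟫)) := by
  have hinv : Tendsto (fun k => ‖y k‖⁻¹) atTop (𝓝 0) := tendsto_inv_atTop_zero.comp hy
  -- the increment of the norm
  have hd : Tendsto (fun k => ‖x k + y k‖ - ‖y k‖) atTop (𝓝 ⟪xt, yt⟫) := by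
    have h1 : Tendsto (fun k => (‖y k‖⁻¹ * ‖x k‖ ^ 2 + 2 * ⟪x k, ‖y k‖⁻¹ • y k⟫) /
        (‖‖y k‖⁻¹ • x k + ‖y k‖⁻¹ • y k‖ + 1)) atTop
        (𝓝 ((0 * ‖xt‖ ^ 2 + 2 * ⟪xt, yt⟫) / (‖(0:ℝ) • xt + yt‖ + 1))) := by
      refine Tendsto.div ?_ ?_ ?_
      · exact (hinv.mul (hx.norm.pow 2)).add ((hx.inner hdir).const_mul 2)
      · exact ((hinv.smul hx).add hdir).norm.add_const 1
      · positivity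
    have h2 : (0 * ‖xt‖ ^ 2 + 2 * ⟪xt, yt⟫) / (‖(0:ℝ) • xt + yt‖ + 1) = ⟪xt, yt⟫ := by
      rw [zero_smul, zero_add, hyt]; ring
    rw [h2] at h1
    refine h1.congr' ?_
    filter_upwards [hy.eventually_gt_atTop 0] with k hk
    rw [← smul_add, norm_smul, inner_smul_right, norm_inv, norm_norm]
    have h3 := norm_add_sq_real (x k) (y k)
    have h4 : 0 < ‖y k‖⁻¹ * ‖x k + y k‖ + 1 := by positivity
    rw [div_eq_iff h4.ne']
    field_simp
    linarith
  have hxy : Tendsto (fun k => ‖x k + y k‖) atTop atTop := by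
    have := hy.atTop_add hd
    simpa using this
  have hint : ∀ a b : ℝ, 0 ≤ a → 0 ≤ b → IntervalIntegrable g volume a b := by
    intro a b ha hb
    refine (hg_cont.mono ?_).intervalIntegrable
    intro s hs
    exact le_trans (le_min ha hb) hs.1
  have herr : Tendsto (fun k => (Gam g (x k + y k) - Gam g (y k)) -
      ginf * (‖x k + y k‖ - ‖y k‖)) atTop (𝓝 0) := by
    have hO : (fun k => (Gam g (x k + y k) - Gam g (y k)) -
        ginf * (‖x k + y k‖ - ‖y k‖)) =o[atTop] (fun k => ‖x k + y k‖ - ‖y k‖) := by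
      rw [Asymptotics.isLittleO_iff]
      intro c hc
      obtain ⟨R, hR⟩ := eventually_atTop.1 (Metric.tendsto_nhds.1 hg_lim c hc)
      filter_upwards [hy.eventually_ge_atTop R, hxy.eventually_ge_atTop R] with k h1 h2
      have e : (Gam g (x k + y k) - Gam g (y k)) - ginf * (‖x k + y k‖ - ‖y k‖) =
          ∫ s in ‖y k‖..‖x k + y k‖, (g s - ginf) := by
        unfold Gam
        rw [intervalIntegral.integral_interval_sub_left
          (hint _ _ le_rfl (norm_nonneg _)) (hint _ _ le_rfl (norm_nonneg _)),
          intervalIntegral.integral_sub (hint _ _ (norm_nonneg _) (norm_nonneg _))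
          intervalIntegrable_const, intervalIntegral.integral_const, smul_eq_mul]
        ring
      rw [e, Real.norm_eq_abs (‖x k + y k‖ - ‖y k‖)]
      refine intervalIntegral.norm_integral_le_of_norm_le_const ?_
      intro s hs
      have hs' : R ≤ s := le_trans (le_min h1 h2) hs.1.le
      have := hR s hs'
      rw [Real.dist_eq] at this
      exact this.le
    exact (Asymptotics.isLittleO_one_iff ℝ).1 (hO.trans_isBigO (hd.isBigO_one ℝ))
  have := herr.add (hd.const_mul ginf)
  simpa using this
end
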